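/- Let q be a real number with q ≠ 0, ±1 and let n ≥ 1. For every function f: ℝ → ℝ and every point x ∈ ℝ: the n-th symmetric Gaussian Riemann derivative _qD^s_n f(x) exists if and only if the n-th symmetric Gaussian Riemann derivative _{1/q}D^s_n f(x) exists, and in that case the two derivatives are equal. -/

import Mathlib

open Filter Topology

noncomputable section

/-- Base-point multipliers `{±1, ±q, …, ±q^{m-1}}`, together with `0` when `n` is even
(where `m = ⌊(n+1)/2⌋`), of the `n`-th symmetric Gaussian Riemann derivative `_qD^s_n`. -/
def symGaussNodes (q : ℝ) (n : ℕ) (k : Fin (n + 1)) : ℝ :=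
  if k.val < (n + 1) / 2 then q ^ k.val
  else if k.val < 2 * ((n + 1) / 2) then -q ^ (k.val - (n + 1) / 2)
  else 0

/-- The `n`-th symmetric Gaussian Riemann derivative `_qD^s_n f (x)` exists and equals `L`:
for the (unique) coefficient vector `A` making the data based at
`(x), x±h, x±qh, …, x±q^{m-1}h` satisfy the `n`-th Vandermonde relations, the defining
limit exists and equals `L`. -/
def QSymGaussDerivAt (q : ℝ) (n : ℕ) (f : ℝ → ℝ) (x L : ℝ) : Prop :=
  ∃ A : Fin (n + 1) → ℝ, (∀ k, A k ≠ 0) ∧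
    (∀ j ≤ n, ∑ k, A k * symGaussNodes q n k ^ j =
      if j = n then (Nat.factorial n : ℝ) else 0) ∧
    Tendsto (fun h : ℝ => (∑ k, A k * f (x + symGaussNodes q n k * h)) / h ^ n)
      (𝓝[≠] (0 : ℝ)) (𝓝 L)

/-- The index involution reversing the order of the positive nodes and of the negative nodes. -/
def symGaussRevIndex (n : ℕ) (k : Fin (n + 1)) : Fin (n + 1) :=
  ⟨if k.val < (n + 1) / 2 then (n + 1) / 2 - 1 - k.val
    else if k.val < 2 * ((n + 1) / 2) then 3 * ((n + 1) / 2) - 1 - k.val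
    else k.val, by have := k.isLt; split_ifs <;> omega⟩

theorem symGaussRevIndex_involutive (n : ℕ) : Function.Involutive (symGaussRevIndex n) := by
  intro k
  ext
  simp only [symGaussRevIndex]
  split_ifs <;> omega

/-- Reversing the indices exchanges `q` and `q⁻¹`, up to a dilation. -/
theorem symGaussNodes_inv_revIndex {q : ℝ} (hq : q ≠ 0) (n : ℕ) (k : Fin (n + 1)) :
    symGaussNodes q⁻¹ n (symGaussRevIndex n k) =
      q⁻¹ ^ ((n + 1) / 2 - 1) * symGaussNodes q n k := by
  have key : ∀ a b : ℕ, q⁻¹ ^ a = q⁻¹ ^ (a + b) * q ^ b := fun a b => by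
    rw [pow_add, mul_assoc, ← mul_pow, inv_mul_cancel₀ hq, one_pow, mul_one]
  have hrev : (symGaussRevIndex n k).val = if k.val < (n + 1) / 2 then (n + 1) / 2 - 1 - k.val
      else if k.val < 2 * ((n + 1) / 2) then 3 * ((n + 1) / 2) - 1 - k.val else k.val := rfl
  unfold symGaussNodes
  by_cases h1 : k.val < (n + 1) / 2
  · rw [if_pos h1] at hrev
    rw [if_pos h1, if_pos (by omega), key _ k.val]
    congr 2
    omega
  · rw [if_neg h1] at hrev
    by_cases h2 : k.val < 2 * ((n + 1) / 2)
    · rw [if_pos h2] at hrev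
      rw [if_neg h1, if_pos h2, if_neg (by omega), if_pos (by omega),
        key _ (k.val - (n + 1) / 2), mul_neg]
      congr 3
      omega
    · rw [if_neg h2] at hrev
      rw [if_neg h1, if_neg h2, if_neg (by omega), if_neg (by omega), mul_zero]

theorem QSymGaussDerivAt.inv {q : ℝ} (hq : q ≠ 0) {n : ℕ} {f : ℝ → ℝ} {x L : ℝ}
    (h : QSymGaussDerivAt q n f x L) : QSymGaussDerivAt q⁻¹ n f x L := by
  obtain ⟨A, hA, hV, hL⟩ := h
  set c : ℝ := q⁻¹ ^ ((n + 1) / 2 - 1)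
  have hc0 : c ≠ 0 := pow_ne_zero _ (inv_ne_zero hq)
  let σ : Equiv.Perm (Fin (n + 1)) := (symGaussRevIndex_involutive n).toPerm
  have hσ : ∀ k, symGaussNodes q⁻¹ n (σ k) = c * symGaussNodes q n k :=
    symGaussNodes_inv_revIndex hq n
  refine ⟨fun k => A (σ.symm k) / c ^ n, fun k => div_ne_zero (hA _) (pow_ne_zero _ hc0),
    fun j hj => ?_, ?_⟩
  · have hsum : ∑ k, A (σ.symm k) / c ^ n * symGaussNodes q⁻¹ n k ^ j =
        c ^ j / c ^ n * ∑ k, A k * symGaussNodes q n k ^ j := by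
      rw [← Equiv.sum_comp σ, Finset.mul_sum]
      refine Finset.sum_congr rfl fun k _ => ?_
      rw [hσ, Equiv.symm_apply_apply, mul_pow]
      ring
    rw [hsum, hV j hj]
    split_ifs with hjn
    · rw [hjn, div_self (pow_ne_zero _ hc0), one_mul]
    · rw [mul_zero]
  · have hscale : Tendsto (fun h : ℝ => c * h) (𝓝[≠] 0) (𝓝[≠] 0) := by
      refine tendsto_nhdsWithin_iff.2 ⟨?_, ?_⟩
      · have : Tendsto (fun h : ℝ => c * h) (𝓝 0) (𝓝 (c * 0)) :=
          (continuous_const_mul c).tendsto 0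
        rw [mul_zero] at this
        exact this.mono_left nhdsWithin_le_nhds
      · filter_upwards [self_mem_nhdsWithin] with h hh
        exact mul_ne_zero hc0 hh
    refine (hL.comp hscale).congr fun h => ?_
    rw [Function.comp_apply,
      ← Equiv.sum_comp σ (fun k => A (σ.symm k) / c ^ n * f (x + symGaussNodes q⁻¹ n k * h)), mul_pow, ← div_div, Finset.sum_div]
    congr 1
    refine Finset.sum_congr rfl fun k _ => ?_
    rw [hσ, Equiv.symm_apply_apply, ← mul_assoc, mul_comm (symGaussNodes q n k) c]
    ring

/-- For `q ≠ 0, ±1` and `n ≥ 1`: `_qD^s_n f(x)` exists iff `_{1/q}D^s_n f(x)` exists, and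
in that case the two derivatives are equal (i.e. they exist with the same value `L`). -/
theorem qSymGaussDeriv_iff_inv_qSymGaussDeriv (q : ℝ) (hq0 : q ≠ 0) (hq1 : q ≠ 1)
    (hqm1 : q ≠ -1) (n : ℕ) (hn : 1 ≤ n) (f : ℝ → ℝ) (x : ℝ) :
    ∀ L : ℝ, QSymGaussDerivAt q n f x L ↔ QSymGaussDerivAt (1 / q) n f x L := by
  intro L
  rw [one_div]
  refine ⟨fun h => h.inv hq0, fun h => ?_⟩
  simpa using h.inv (inv_ne_zero hq0)
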